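/- Suppose 1 ≤ x < 2 and ε > 0, and let I ≥ 0. The Euler-step output of the logarithm recurrence, y = L_I + (x − E_I)/E_I, satisfies 0 ≤ y − ln(x) ≤ (x − E_I)²/(2·E_I²) ≤ (x − E_I)²/2; in particular, if x − E_I ≤ √(2ε) then |y − ln(x)| ≤ ε. -/

import Mathlib

/-- Restoring shift-and-add recurrence for computing `ln x`:
`(logRec x n).1 = Eₙ` and `(logRec x n).2 = Lₙ`, with `E₀ = 1`, `L₀ = 0`,
`dₙ = 1` iff `Eₙ (1 + 2⁻ⁿ) ≤ x`, `Eₙ₊₁ = Eₙ (1 + dₙ 2⁻ⁿ)`,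
`Lₙ₊₁ = Lₙ + dₙ ln (1 + 2⁻ⁿ)`. -/
noncomputable def logRec (x : ℝ) : ℕ → ℝ × ℝ
  | 0 => (1, 0)
  | n + 1 =>
    let p := logRec x n
    if p.1 * (1 + (2 : ℝ) ^ (-(n : ℤ))) ≤ x then
      (p.1 * (1 + (2 : ℝ) ^ (-(n : ℤ))), p.2 + Real.log (1 + (2 : ℝ) ^ (-(n : ℤ))))
    else p

theorem logRec_inv (x : ℝ) (hx1 : 1 ≤ x) (n : ℕ) :
    1 ≤ (logRec x n).1 ∧ (logRec x n).1 ≤ x ∧ (logRec x n).2 = Real.log (logRec x n).1 := by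
  induction n with
  | zero => simp [logRec, hx1]
  | succ n ih =>
    obtain ⟨h1, h2, h3⟩ := ih
    have hp : (0 : ℝ) < (2 : ℝ) ^ (-(n : ℤ)) := by positivity
    simp only [logRec]
    split_ifs with h
    · refine ⟨by nlinarith, h, ?_⟩
      rw [Real.log_mul (by positivity) (by positivity), h3]
    · exact ⟨h1, h2, h3⟩

/-- If `1 ≤ x < 2` and `ε > 0`, the Euler-step output
`y = L_I + (x − E_I)/E_I` satisfies
`0 ≤ y − ln x ≤ (x − E_I)²/(2 E_I²) ≤ (x − E_I)²/2`; in particular, if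
`x − E_I ≤ √(2ε)` then `|y − ln x| ≤ ε`. -/
theorem logRec_euler_step_error (x : ℝ) (hx1 : 1 ≤ x) (hx2 : x < 2)
    (ε : ℝ) (hε : 0 < ε) (I : ℕ) :
    0 ≤ ((logRec x I).2 + (x - (logRec x I).1) / (logRec x I).1) - Real.log x ∧
    ((logRec x I).2 + (x - (logRec x I).1) / (logRec x I).1) - Real.log x ≤
      (x - (logRec x I).1) ^ 2 / (2 * (logRec x I).1 ^ 2) ∧
    (x - (logRec x I).1) ^ 2 / (2 * (logRec x I).1 ^ 2) ≤ (x - (logRec x I).1) ^ 2 / 2 ∧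
    (x - (logRec x I).1 ≤ Real.sqrt (2 * ε) →
      |((logRec x I).2 + (x - (logRec x I).1) / (logRec x I).1) - Real.log x| ≤ ε) := by
  obtain ⟨h1, h2, h3⟩ := logRec_inv x hx1 I
  rw [h3]
  generalize (logRec x I).1 = E at *
  have hE : 0 < E := by linarith
  obtain ⟨t, ht⟩ : ∃ t, t = (x - E) / E := ⟨_, rfl⟩
  have ht0 : 0 ≤ t := ht ▸ div_nonneg (by linarith) hE.le
  have hx : x = E * (1 + t) := by rw [ht]; field_simp; ring
  have hlog : Real.log x = Real.log E + Real.log (1 + t) := by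
    rw [hx, Real.log_mul (by positivity) (by positivity)]
  have hsq : (x - E) ^ 2 / (2 * E ^ 2) = t ^ 2 / 2 := by rw [ht]; field_simp
  have hup : Real.log (1 + t) ≤ t := by
    have := Real.log_le_sub_one_of_pos (show 0 < 1 + t by linarith)
    linarith
  have hlo : t - t ^ 2 / 2 ≤ Real.log (1 + t) := by
    refine le_trans ?_ (Real.le_log_one_add_of_nonneg ht0)
    rw [le_div_iff₀ (by linarith)]
    nlinarith [pow_nonneg ht0 3]
  have hc : (x - E) ^ 2 / (2 * E ^ 2) ≤ (x - E) ^ 2 / 2 := by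
    apply div_le_div_of_nonneg_left (sq_nonneg _) (by norm_num)
    nlinarith
  have hb : Real.log E + (x - E) / E - Real.log x ≤ (x - E) ^ 2 / (2 * E ^ 2) := by
    rw [hsq, hlog, ← ht]; linarith
  have ha : 0 ≤ Real.log E + (x - E) / E - Real.log x := by
    rw [hlog, ← ht]; linarith
  refine ⟨ha, hb, hc, fun hs => ?_⟩
  rw [abs_of_nonneg ha]
  have h4 : (x - E) ^ 2 ≤ 2 * ε := by
    calc (x - E) ^ 2 ≤ Real.sqrt (2 * ε) ^ 2 := pow_le_pow_left₀ (by linarith) hs 2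
      _ = 2 * ε := Real.sq_sqrt (by linarith)
  linarith
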